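/- In a smooth-convex setting, the lower-contour-set inclusion condition of Monotonicity is equivalent to a half-space condition: L^U(p_i, u*) ⊆ L^U(q_i, u*) if and only if H^−(p_i, p_i·u*) ∩ H^−(f(p), f(p)·u*) ⊆ H^−(q_i, q_i·u*), where u* = u(f(p)). -/

import Mathlib

/-- Inner product of two vectors in `ℝ^S`. -/
def dotp {S : Type*} [Fintype S] (p v : S → ℝ) : ℝ := ∑ s, p s * v s

theorem dotp_add {S : Type*} [Fintype S] (p v w : S → ℝ) :
    dotp p (v + w) = dotp p v + dotp p w := by
  simp [dotp, mul_add, Finset.sum_add_distrib]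

theorem dotp_smul {S : Type*} [Fintype S] (p v : S → ℝ) (t : ℝ) :
    dotp p (t • v) = t * dotp p v := by
  simp [dotp, Finset.mul_sum, mul_left_comm]

theorem smul_dotp {S : Type*} [Fintype S] (p v : S → ℝ) (t : ℝ) :
    dotp (t • p) v = t * dotp p v := by
  simp [dotp, Finset.mul_sum, mul_assoc]

theorem isLinearMap_dotp {S : Type*} [Fintype S] (p : S → ℝ) : IsLinearMap ℝ (dotp p) :=
  ⟨dotp_add p, fun t v => dotp_smul p v t⟩

theorem continuous_dotp {S : Type*} [Fintype S] (p : S → ℝ) : Continuous (dotp p) := by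
  unfold dotp
  fun_prop

theorem dotp_const {S : Type*} [Fintype S] {p : S → ℝ} (hp : p ∈ stdSimplex ℝ S) (c : ℝ) :
    dotp p (fun _ => c) = c := by
  simp [dotp, ← Finset.sum_mul, hp.2]

theorem exists_eq_dotp {S : Type*} [Fintype S] (φ : (S → ℝ) →L[ℝ] ℝ) :
    ∃ π : S → ℝ, ∀ v, φ v = dotp π v := by
  classical
  refine ⟨fun s => φ (Pi.single s 1), fun v => ?_⟩
  have h := LinearMap.pi_apply_eq_sum_univ φ.toLinearMap v
  simp only [ContinuousLinearMap.coe_coe, smul_eq_mul] at h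
  rw [h, dotp]
  refine Finset.sum_congr rfl fun s _ => ?_
  rw [mul_comm]
  congr 2
  ext j
  simp [Pi.single_apply, eq_comm]

/-- If every nonzero functional supporting the convex set `𝒰` at `b` is a positive multiple of `f`,
then any open convex cone with apex `b` that contains a point `b + d` with `f · d < 0` meets `𝒰`. -/
theorem exists_mem_of_unique_support {S : Type*} [Fintype S] {𝒰 O : Set (S → ℝ)}
    (hconv : Convex ℝ 𝒰) {b f d : S → ℝ} (hb : b ∈ 𝒰)
    (hunique : ∀ π : S → ℝ, π ≠ 0 → (∀ v ∈ 𝒰, dotp π v ≤ dotp π b) → ∃ c > (0 : ℝ), π = c • f)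
    (hOc : Convex ℝ O) (hOo : IsOpen O) (hray : ∀ t > (0 : ℝ), b + t • d ∈ O)
    (hd : dotp f d < 0) : ∃ v ∈ 𝒰, v ∈ O := by
  by_contra! hdisj
  obtain ⟨φ, a, hO, hU⟩ := geometric_hahn_banach_open hOc hOo hconv
    (Set.disjoint_left.2 fun v hvO hvU => hdisj v hvU hvO)
  have ha : φ b ≤ a := by
    by_contra! hlt
    have hlim : Filter.Tendsto (fun t : ℝ => φ (b + t • d)) (nhdsWithin 0 (Set.Ioi 0))
        (nhds (φ b)) := by
      have : Continuous fun t : ℝ => φ (b + t • d) := by fun_prop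
      simpa using (this.tendsto 0).mono_left nhdsWithin_le_nhds
    refine absurd (le_of_tendsto hlim ?_) hlt.not_ge
    filter_upwards [self_mem_nhdsWithin] with t ht using (hO _ (hray t ht)).le
  have hneg : φ d < 0 := by
    have h₁ := hO _ (hray 1 one_pos)
    have h₂ := hU b hb
    simp only [one_smul, map_add] at h₁
    linarith
  obtain ⟨π, hπ⟩ := exists_eq_dotp (-φ)
  simp only [neg_apply] at hπ
  obtain ⟨c, hc, rfl⟩ := hunique π
    (by
      rintro rfl
      have := hπ d
      simp only [dotp, Pi.zero_apply, zero_mul, Finset.sum_const_zero] at this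
      linarith)
    (fun v hv => by
      rw [← hπ, ← hπ]
      linarith [hU v hv])
  have := hπ d
  rw [smul_dotp] at this
  nlinarith

/-- for a smooth compact convex set `𝒰` of utility acts supported
at `u*` by the aggregate belief `fp`, the lower-contour-set inclusion
`L^𝒰(p, u*) ⊆ L^𝒰(q, u*)` is equivalent to the half-space inclusion
`H⁻(p, p·u*) ∩ H⁻(fp, fp·u*) ⊆ H⁻(q, q·u*)`. -/
theorem stmt14 {S : Type*} [Fintype S]
    (𝒰 : Set (S → ℝ)) (hcomp : IsCompact 𝒰) (hconv : Convex ℝ 𝒰)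
    (hsmooth : ∀ b ∈ 𝒰, ∀ π₁ π₂ : S → ℝ, π₁ ≠ 0 → π₂ ≠ 0 →
      (∀ v ∈ 𝒰, dotp π₁ v ≤ dotp π₁ b) → (∀ v ∈ 𝒰, dotp π₂ v ≤ dotp π₂ b) →
      ∃ c > (0:ℝ), π₂ = c • π₁)
    (ustar : S → ℝ) (hustar : ustar ∈ 𝒰)
    (fp : S → ℝ) (hfp : fp ∈ stdSimplex ℝ S)
    (hsupp : ∀ v ∈ 𝒰, dotp fp v ≤ dotp fp ustar)
    (p q : S → ℝ) (hp : p ∈ stdSimplex ℝ S) (hq : q ∈ stdSimplex ℝ S) :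
    ({v | v ∈ 𝒰 ∧ dotp p v ≤ dotp p ustar} ⊆ {v | v ∈ 𝒰 ∧ dotp q v ≤ dotp q ustar}) ↔
    ({v : S → ℝ | dotp p v ≤ dotp p ustar} ∩ {v | dotp fp v ≤ dotp fp ustar}
      ⊆ {v | dotp q v ≤ dotp q ustar}) := by
  constructor
  · rintro hsub v ⟨hpv, hfv⟩
    simp only [Set.mem_ofPred_eq] at hpv hfv ⊢
    by_contra! hqv
    have hfp0 : fp ≠ 0 := by
      rintro rfl
      simpa using hfp.2
    set ε : ℝ := (dotp q v - dotp q ustar) / 2 with hε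
    set d : S → ℝ := v + ((-1 : ℝ) • ustar + fun _ => -ε) with hd
    have hdot : ∀ r ∈ stdSimplex ℝ S, dotp r d = dotp r v - dotp r ustar - ε := by
      intro r hr
      rw [hd, dotp_add, dotp_add, dotp_smul, dotp_const hr]
      ring
    have hpd : dotp p d < 0 := by
      rw [hdot p hp]
      linarith
    have hfd : dotp fp d < 0 := by
      rw [hdot fp hfp]
      linarith
    have hqd : 0 < dotp q d := by
      rw [hdot q hq]
      linarith
    obtain ⟨w, hw, hpw, hqw⟩ := exists_mem_of_unique_support
      (O := {w | dotp p w < dotp p ustar} ∩ {w | dotp q ustar < dotp q w}) hconv hustar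
      (fun π hπ h => hsmooth ustar hustar fp π hfp0 hπ hsupp h)
      ((convex_halfSpace_lt (isLinearMap_dotp p) _).inter
        (convex_halfSpace_gt (isLinearMap_dotp q) _))
      ((isOpen_lt (continuous_dotp p) continuous_const).inter
        (isOpen_lt continuous_const (continuous_dotp q)))
      (fun t ht => by
        simp only [Set.mem_inter_iff, Set.mem_ofPred_eq, dotp_add, dotp_smul]
        exact ⟨by nlinarith, by nlinarith⟩)
      hfd
    exact absurd (hsub ⟨hw, le_of_lt hpw⟩).2 (not_le.2 hqw)
  · rintro h v ⟨hv, hpv⟩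
    exact ⟨hv, h ⟨hpv, hsupp v hv⟩⟩
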